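/- Let Ω be the right triangle {(x,y) : 0 ≤ x ≤ a, 0 ≤ y ≤ 1 − x/a} with a > 0. Let (u_j) be a sequence of real-valued functions, each C² on an open neighborhood of Ω, and (h_j) positive reals with h_j → 0, such that for each j: −h_j²Δu_j = u_j on Ω, u_j = 0 on ∂Ω, and ∫_Ω u_j² dV = 1. Assume the spatial equidistribution property: for every open axis-aligned rectangle R ⊂ ℝ², ∫_{Ω∩R} u_j² dV → Area(Ω∩R)/Area(Ω) as j → ∞. Then limsup_{j→∞} ∫_Ω |h_j ∂_x u_j|² dV ≤ 7/8. -/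

import Mathlib

open Real MeasureTheory Filter

/-- The right triangle `Ω = {(x,y) : 0 ≤ x ≤ a, 0 ≤ y ≤ 1 - x/a}`. -/
def Omg (a : ℝ) : Set (ℝ × ℝ) :=
  {p | 0 ≤ p.1 ∧ p.1 ≤ a ∧ 0 ≤ p.2 ∧ p.2 ≤ 1 - p.1 / a}

lemma Omg_isClosed (a : ℝ) : IsClosed (Omg a) := by
  have e : Omg a = {p : ℝ × ℝ | 0 ≤ p.1} ∩ ({p | p.1 ≤ a} ∩ ({p | 0 ≤ p.2} ∩
      {p | p.2 ≤ 1 - p.1 / a})) := by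
    ext p; simp [Omg]
  rw [e]
  refine (isClosed_le continuous_const continuous_fst).inter
    ((isClosed_le continuous_fst continuous_const).inter
    ((isClosed_le continuous_const continuous_snd).inter
     (isClosed_le continuous_snd (by fun_prop))))

lemma Omg_sub (a : ℝ) (ha : 0 < a) : Omg a ⊆ Set.Icc 0 a ×ˢ Set.Icc 0 1 := by
  rintro ⟨x, y⟩ ⟨h1, h2, h3, h4⟩
  simp only at h1 h2 h3 h4
  have := div_nonneg h1 ha.le
  exact ⟨⟨h1, h2⟩, h3, by simp only; linarith⟩

lemma Omg_isCompact (a : ℝ) (ha : 0 < a) : IsCompact (Omg a) :=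
  (isCompact_Icc.prod isCompact_Icc).of_isClosed_subset (Omg_isClosed a) (Omg_sub a ha)

lemma Omg_mem1 {a : ℝ} (_ha : 0 < a) (x y : ℝ) :
    (x, y) ∈ Omg a ↔ x ∈ Set.Icc 0 a ∧ y ∈ Set.Icc 0 (1 - x / a) := by
  simp [Omg, and_assoc]

lemma Omg_mem2 {a : ℝ} (ha : 0 < a) (x y : ℝ) :
    (x, y) ∈ Omg a ↔ y ∈ Set.Icc 0 1 ∧ x ∈ Set.Icc 0 (a * (1 - y)) := by
  rw [Omg_mem1 ha]
  have key : y ≤ 1 - x / a ↔ x ≤ a * (1 - y) := by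
    rw [le_sub_comm, div_le_iff₀ ha, mul_comm]
  constructor
  · rintro ⟨⟨h1, h2⟩, h3, h4⟩
    have := div_nonneg h1 ha.le
    exact ⟨⟨h3, by linarith⟩, h1, key.1 h4⟩
  · rintro ⟨⟨h1, h2⟩, h3, h4⟩
    refine ⟨⟨h3, by nlinarith⟩, h1, key.2 h4⟩

lemma fub1 {a : ℝ} (ha : 0 < a) {f : ℝ × ℝ → ℝ} (hf : IntegrableOn f (Omg a)) :
    ∫ p in Omg a, f p = ∫ x in (0:ℝ)..a, ∫ y in (0:ℝ)..(1 - x / a), f (x, y) := by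
  have hm := (Omg_isClosed a).measurableSet
  rw [← integral_indicator hm, Measure.volume_eq_prod, integral_prod]
  · rw [intervalIntegral.integral_of_le ha.le, ← integral_Icc_eq_integral_Ioc,
      ← integral_indicator measurableSet_Icc]
    congr 1; ext x
    by_cases hx : x ∈ Set.Icc 0 a
    · have h1 : 0 ≤ 1 - x / a := by
        have := (div_le_one ha).2 hx.2; linarith
      rw [Set.indicator_of_mem hx, intervalIntegral.integral_of_le h1,
        ← integral_Icc_eq_integral_Ioc, ← integral_indicator measurableSet_Icc]
      congr 1; ext y
      simp only [Set.indicator, Omg_mem1 ha, hx, true_and]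
    · rw [Set.indicator_of_notMem hx]
      simp only [Set.indicator, Omg_mem1 ha, hx, false_and, if_false, integral_zero]
  · rw [← Measure.volume_eq_prod]; exact (integrable_indicator_iff hm).2 hf

lemma fub2 {a : ℝ} (ha : 0 < a) {f : ℝ × ℝ → ℝ} (hf : IntegrableOn f (Omg a)) :
    ∫ p in Omg a, f p = ∫ y in (0:ℝ)..1, ∫ x in (0:ℝ)..(a * (1 - y)), f (x, y) := by
  have hm := (Omg_isClosed a).measurableSet
  rw [← integral_indicator hm, Measure.volume_eq_prod, integral_prod_symm]
  · rw [intervalIntegral.integral_of_le zero_le_one, ← integral_Icc_eq_integral_Ioc,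
      ← integral_indicator measurableSet_Icc]
    congr 1; ext y
    by_cases hy : y ∈ Set.Icc (0:ℝ) 1
    · have h1 : 0 ≤ a * (1 - y) := mul_nonneg ha.le (by linarith [hy.2])
      rw [Set.indicator_of_mem hy, intervalIntegral.integral_of_le h1,
        ← integral_Icc_eq_integral_Ioc, ← integral_indicator measurableSet_Icc]
      congr 1; ext x
      simp only [Set.indicator, Omg_mem2 ha, hy, true_and]
    · rw [Set.indicator_of_notMem hy]
      simp only [Set.indicator, Omg_mem2 ha, hy, false_and, if_false, integral_zero]
  · rw [← Measure.volume_eq_prod]; exact (integrable_indicator_iff hm).2 hf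

lemma div_thm {a : ℝ} (ha : 0 < a) {F1 F2 D1 D2 : ℝ × ℝ → ℝ}
    (c1 : ContinuousOn F1 (Omg a)) (c2 : ContinuousOn F2 (Omg a))
    (d1 : ContinuousOn D1 (Omg a)) (d2 : ContinuousOn D2 (Omg a))
    (e1 : ∀ x y, (x, y) ∈ Omg a → HasDerivAt (fun s => F1 (s, y)) (D1 (x, y)) x)
    (e2 : ∀ x y, (x, y) ∈ Omg a → HasDerivAt (fun s => F2 (x, s)) (D2 (x, y)) y)
    (b1 : ∀ y ∈ Set.Icc (0:ℝ) 1, F1 (0, y) = 0)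
    (b2 : ∀ x ∈ Set.Icc 0 a, F2 (x, 0) = 0)
    (b3 : ∀ x ∈ Set.Icc 0 a, F1 (x, 1 - x / a) / a + F2 (x, 1 - x / a) = 0) :
    ∫ p in Omg a, (D1 p + D2 p) = 0 := by
  have hc := Omg_isCompact a ha
  have i1 : IntegrableOn D1 (Omg a) := d1.integrableOn_compact hc
  have i2 : IntegrableOn D2 (Omg a) := d2.integrableOn_compact hc
  rw [integral_add i1 i2, fub2 ha i1, fub1 ha i2]
  have s1 : ∫ y in (0:ℝ)..1, ∫ x in (0:ℝ)..(a * (1 - y)), D1 (x, y)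
      = ∫ y in (0:ℝ)..1, F1 (a * (1 - y), y) := by
    apply intervalIntegral.integral_congr
    intro y hy
    rw [Set.uIcc_of_le zero_le_one] at hy
    have h1 : 0 ≤ a * (1 - y) := mul_nonneg ha.le (by linarith [hy.2])
    have hmem : ∀ x ∈ Set.uIcc 0 (a * (1 - y)), (x, y) ∈ Omg a := by
      intro x hx
      rw [Set.uIcc_of_le h1] at hx
      exact (Omg_mem2 ha x y).2 ⟨hy, hx⟩
    have := intervalIntegral.integral_eq_sub_of_hasDerivAt
      (f := fun s => F1 (s, y)) (f' := fun s => D1 (s, y)) (a := 0) (b := a * (1 - y))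
      (fun x hx => e1 x y (hmem x hx))
      (ContinuousOn.intervalIntegrable
        (d1.comp (f := fun s : ℝ => (s, y)) (by fun_prop) (fun x hx => hmem x hx)))
    simp only [this, b1 y hy, sub_zero]
  have s2 : ∫ x in (0:ℝ)..a, ∫ y in (0:ℝ)..(1 - x / a), D2 (x, y)
      = ∫ x in (0:ℝ)..a, F2 (x, 1 - x / a) := by
    apply intervalIntegral.integral_congr
    intro x hx
    rw [Set.uIcc_of_le ha.le] at hx
    have h1 : 0 ≤ 1 - x / a := by
      have := (div_le_one ha).2 hx.2; linarith
    have hmem : ∀ y ∈ Set.uIcc 0 (1 - x / a), (x, y) ∈ Omg a := by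
      intro y hy
      rw [Set.uIcc_of_le h1] at hy
      exact (Omg_mem1 ha x y).2 ⟨hx, hy⟩
    have := intervalIntegral.integral_eq_sub_of_hasDerivAt
      (f := fun s => F2 (x, s)) (f' := fun s => D2 (x, s)) (a := 0) (b := 1 - x / a)
      (fun y hy => e2 x y (hmem y hy))
      (ContinuousOn.intervalIntegrable
        (d2.comp (f := fun s : ℝ => (x, s)) (by fun_prop) (fun x hx => hmem x hx)))
    simp only [this, b2 x hx, sub_zero]
  have s3 : ∫ y in (0:ℝ)..1, F1 (a * (1 - y), y)
      = ∫ x in (0:ℝ)..a, F1 (x, 1 - x / a) / a := by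
    have := intervalIntegral.integral_comp_sub_mul
      (f := fun x => F1 (x, 1 - x / a)) (a := 0) (b := 1) (c := a) ha.ne' a
    have e : ∀ y : ℝ, F1 (a - a * y, 1 - (a - a * y) / a) = F1 (a * (1 - y), y) := by
      intro y
      congr 2
      · ring
      · field_simp; ring
    simp only [e] at this
    rw [this, intervalIntegral.integral_div]
    simp [div_eq_inv_mul]
  have hmem : ∀ x ∈ Set.uIcc 0 a, (x, 1 - x / a) ∈ Omg a := by
    intro x hx
    rw [Set.uIcc_of_le ha.le] at hx
    have h1 : 0 ≤ 1 - x / a := by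
      have := (div_le_one ha).2 hx.2; linarith
    exact (Omg_mem1 ha x _).2 ⟨hx, h1, le_rfl⟩
  have k1 : ContinuousOn (fun x : ℝ => F1 (x, 1 - x / a)) (Set.uIcc 0 a) :=
    c1.comp (f := fun x : ℝ => (x, 1 - x / a)) (by fun_prop) hmem
  have k2 : ContinuousOn (fun x : ℝ => F2 (x, 1 - x / a)) (Set.uIcc 0 a) :=
    c2.comp (f := fun x : ℝ => (x, 1 - x / a)) (by fun_prop) hmem
  rw [s1, s2, s3, ← intervalIntegral.integral_add (k1.div_const a).intervalIntegrable
    k2.intervalIntegrable]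
  rw [intervalIntegral.integral_congr (g := fun _ => 0)]
  · simp
  · intro x hx
    rw [Set.uIcc_of_le ha.le] at hx
    exact b3 x hx

/-- area of the part of the triangle with `x > c` -/
lemma area_part {a : ℝ} (ha : 0 < a) {t : ℝ} (ht0 : 0 ≤ t) (ht : t ≤ 1) :
    (volume (Omg a ∩ (Set.Ioo (a * t) (2 * a) ×ˢ Set.Ioo (-1:ℝ) 2))).toReal
      = a / 2 * (1 - t) ^ 2 := by
  set S := Set.Ioo (a * t) (2 * a) ×ˢ Set.Ioo (-1:ℝ) 2 with hS
  have hSm : MeasurableSet S := measurableSet_Ioo.prod measurableSet_Ioo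
  have hm := (Omg_isClosed a).measurableSet
  have h1 : (volume (Omg a ∩ S)).toReal = ∫ p in Omg a, S.indicator (fun _ => (1:ℝ)) p := by
    rw [setIntegral_indicator hSm]; simp [Measure.real]
  rw [h1]
  have hat : a * t ≤ a := by nlinarith
  have hat0 : 0 ≤ a * t := by positivity
  have hfin : volume (Omg a) ≠ ⊤ := (Omg_isCompact a ha).measure_lt_top.ne
  rw [fub1 ha (((integrableOn_const (C := (1:ℝ)) hfin)).indicator hSm)]
  have h2 : ∀ x ∈ Set.uIcc 0 a, (∫ y in (0:ℝ)..(1 - x / a), S.indicator (fun _ => (1:ℝ)) (x, y))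
      = (Set.Ioi (a * t)).indicator (fun x => 1 - x / a) x := by
    intro x hx
    rw [Set.uIcc_of_le ha.le] at hx
    have h1 : 0 ≤ 1 - x / a := by
      have := (div_le_one ha).2 hx.2; linarith
    have h3 : 0 ≤ x / a := div_nonneg hx.1 ha.le
    by_cases hxt : a * t < x
    · rw [Set.indicator_of_mem (by exact hxt)]
      rw [intervalIntegral.integral_congr (g := fun _ => 1)]
      · simp
      · intro y hy
        rw [Set.uIcc_of_le h1] at hy
        apply Set.indicator_of_mem
        exact ⟨⟨hxt, by simp only; linarith [hx.2]⟩, by simp only; linarith [hy.1], by simp only; linarith [hy.2]⟩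
    · rw [Set.indicator_of_notMem (by exact hxt)]
      rw [intervalIntegral.integral_congr (g := fun _ => 0)]
      · simp
      · intro y hy
        apply Set.indicator_of_notMem
        intro h; exact hxt h.1.1
  rw [intervalIntegral.integral_congr h2, intervalIntegral.integral_of_le ha.le,
    setIntegral_indicator measurableSet_Ioi]
  have h4 : Set.Ioc 0 a ∩ Set.Ioi (a * t) = Set.Ioc (a * t) a := by
    ext x; simp only [Set.mem_inter_iff, Set.mem_Ioc, Set.mem_Ioi]
    constructor
    · rintro ⟨⟨_, h⟩, h'⟩; exact ⟨h', h⟩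
    · rintro ⟨h', h⟩; exact ⟨⟨by linarith, h⟩, h'⟩
  rw [h4, ← intervalIntegral.integral_of_le hat, intervalIntegral.integral_sub (by simp)
    (by apply Continuous.intervalIntegrable; fun_prop), intervalIntegral.integral_div]
  simp
  field_simp
  ring

lemma area_Omg {a : ℝ} (ha : 0 < a) : (volume (Omg a)).toReal = a / 2 := by
  have hm := (Omg_isClosed a).measurableSet
  have hfin : volume (Omg a) ≠ ⊤ := (Omg_isCompact a ha).measure_lt_top.ne
  have h1 : (volume (Omg a)).toReal = ∫ p in Omg a, (1:ℝ) := by simp [Measure.real]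
  rw [h1, fub1 ha (integrableOn_const hfin)]
  simp only [intervalIntegral.integral_const, smul_eq_mul, mul_one, sub_zero]
  rw [intervalIntegral.integral_sub (by simp)
    (by apply Continuous.intervalIntegrable; fun_prop), intervalIntegral.integral_div]
  simp
  field_simp
  ring

lemma frontier_of_dir {a : ℝ} {p v : ℝ × ℝ} (hp : p ∈ Omg a)
    (hv : ∀ e : ℝ, 0 < e → p + e • v ∉ Omg a) : p ∈ frontier (Omg a) := by
  rw [(Omg_isClosed a).frontier_eq]
  refine ⟨hp, fun hi => ?_⟩
  have hc : Tendsto (fun e : ℝ => p + e • v) (nhds 0) (nhds p) := by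
    have : Continuous (fun e : ℝ => p + e • v) := by fun_prop
    simpa using this.tendsto 0
  have h1 : ∀ᶠ e in nhdsWithin (0:ℝ) (Set.Ioi 0), p + e • v ∈ Omg a :=
    (hc.mono_left nhdsWithin_le_nhds).eventually (mem_interior_iff_mem_nhds.1 hi)
  obtain ⟨e, he, he'⟩ := (h1.and self_mem_nhdsWithin).exists
  exact hv e he' he

lemma fr_left {a : ℝ} (ha : 0 < a) {y : ℝ} (hy : y ∈ Set.Icc (0:ℝ) 1) :
    (0, y) ∈ frontier (Omg a) := by
  apply frontier_of_dir (v := (-1, 0))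
  · exact (Omg_mem2 ha 0 y).2 ⟨hy, le_rfl, mul_nonneg ha.le (by linarith [hy.2])⟩
  · rintro e he ⟨h1, -⟩
    simp at h1; linarith

lemma fr_bot {a : ℝ} (ha : 0 < a) {x : ℝ} (hx : x ∈ Set.Icc 0 a) :
    (x, 0) ∈ frontier (Omg a) := by
  apply frontier_of_dir (v := (0, -1))
  · exact (Omg_mem1 ha x 0).2 ⟨hx, le_rfl, by have := (div_le_one ha).2 hx.2; linarith⟩
  · rintro e he ⟨-, -, h1, -⟩
    simp at h1; linarith

lemma fr_hyp {a : ℝ} (ha : 0 < a) {x : ℝ} (hx : x ∈ Set.Icc 0 a) :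
    (x, 1 - x / a) ∈ frontier (Omg a) := by
  apply frontier_of_dir (v := (0, 1))
  · exact (Omg_mem1 ha x _).2 ⟨hx, by have := (div_le_one ha).2 hx.2; linarith, le_rfl⟩
  · rintro e he ⟨-, -, -, h1⟩
    simp at h1; linarith

lemma energy_id {a k : ℝ} (ha : 0 < a) {u ux uy uxx uxy uyy : ℝ × ℝ → ℝ}
    (cu : ContinuousOn u (Omg a)) (cux : ContinuousOn ux (Omg a)) (cuy : ContinuousOn uy (Omg a))
    (cuxx : ContinuousOn uxx (Omg a)) (cuxy : ContinuousOn uxy (Omg a))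
    (cuyy : ContinuousOn uyy (Omg a))
    (dux : ∀ x y, (x, y) ∈ Omg a → HasDerivAt (fun s => u (s, y)) (ux (x, y)) x)
    (duy : ∀ x y, (x, y) ∈ Omg a → HasDerivAt (fun s => u (x, s)) (uy (x, y)) y)
    (duxx : ∀ x y, (x, y) ∈ Omg a → HasDerivAt (fun s => ux (s, y)) (uxx (x, y)) x)
    (duxy : ∀ x y, (x, y) ∈ Omg a → HasDerivAt (fun s => ux (x, s)) (uxy (x, y)) y)
    (duyx : ∀ x y, (x, y) ∈ Omg a → HasDerivAt (fun s => uy (s, y)) (uxy (x, y)) x)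
    (duyy : ∀ x y, (x, y) ∈ Omg a → HasDerivAt (fun s => uy (x, s)) (uyy (x, y)) y)
    (heig : ∀ p ∈ Omg a, - k * (uxx p + uyy p) = u p)
    (hb : ∀ p ∈ frontier (Omg a), u p = 0)
    (t1 : ∀ y ∈ Set.Ioo (0:ℝ) 1, uy (0, y) = 0)
    (t2 : ∀ x ∈ Set.Ioo 0 a, ux (x, 0) = 0)
    (t3 : ∀ x ∈ Set.Ioo 0 a, ux (x, 1 - x / a) = uy (x, 1 - x / a) / a) :
    ∫ p in Omg a, (4 * (k * ux p ^ 2) - (2 + 4 * (p.1 / a)) * u p ^ 2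
      + 4 * (p.1 / a + p.2) * (k * uy p ^ 2)) = 0 := by
  have main := div_thm ha
    (F1 := fun p => k * (p.1 * (1 - p.1 / a) * (ux p ^ 2 - uy p ^ 2)
        + 2 * (-(p.2 * (1 - p.2))) * (ux p * uy p)
        + (2 * (p.1 / a) + 2 * p.2 + 2) * (u p * ux p))
      + p.1 * (1 - p.1 / a) * u p ^ 2 - k * u p ^ 2 / a)
    (F2 := fun p => k * (-(p.2 * (1 - p.2)) * (uy p ^ 2 - ux p ^ 2)
        + 2 * (p.1 * (1 - p.1 / a)) * (ux p * uy p)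
        + (2 * (p.1 / a) + 2 * p.2 + 2) * (u p * uy p))
      + -(p.2 * (1 - p.2)) * u p ^ 2 - k * u p ^ 2)
    (D1 := fun p => k * ((1 - 2 * (p.1 / a)) * (ux p ^ 2 - uy p ^ 2)
        + p.1 * (1 - p.1 / a) * (2 * ux p * uxx p - 2 * uy p * uxy p)
        + 2 * (-(p.2 * (1 - p.2))) * (uxx p * uy p + ux p * uxy p)
        + 2 / a * (u p * ux p)
        + (2 * (p.1 / a) + 2 * p.2 + 2) * (ux p ^ 2 + u p * uxx p))
      + (1 - 2 * (p.1 / a)) * u p ^ 2 + p.1 * (1 - p.1 / a) * (2 * u p * ux p)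
      - k * (2 * u p * ux p) / a)
    (D2 := fun p => k * (-(1 - 2 * p.2) * (uy p ^ 2 - ux p ^ 2)
        + -(p.2 * (1 - p.2)) * (2 * uy p * uyy p - 2 * ux p * uxy p)
        + 2 * (p.1 * (1 - p.1 / a)) * (uxy p * uy p + ux p * uyy p)
        + 2 * (u p * uy p)
        + (2 * (p.1 / a) + 2 * p.2 + 2) * (uy p ^ 2 + u p * uyy p))
      + -(1 - 2 * p.2) * u p ^ 2 + -(p.2 * (1 - p.2)) * (2 * u p * uy p)
      - k * (2 * u p * uy p))
    (by fun_prop) (by fun_prop) (by fun_prop) (by fun_prop) ?_ ?_ ?_ ?_ ?_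
  · rw [← main]
    apply setIntegral_congr_fun (Omg_isClosed a).measurableSet
    intro p hp
    have e := heig p hp
    simp only
    linear_combination (-2 * (p.1 * (1 - p.1 / a)) * ux p + 2 * (p.2 * (1 - p.2)) * uy p
      - (2 * (p.1 / a) + 2 * p.2 + 2) * u p) * -e
  · intro x y hm
    have a0 := dux x y hm
    have a1 := duxx x y hm
    have a2 := duyx x y hm
    have i := hasDerivAt_id x
    have V := i.mul ((hasDerivAt_const x (1:ℝ)).sub (i.div_const a))
    have P := (((i.div_const a).const_mul 2).add_const (2 * y)).add_const 2
    have := ((((V.mul ((a1.pow 2).sub (a2.pow 2))).add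
      ((a1.mul a2).const_mul (2 * (-(y * (1 - y)))))).add (P.mul (a0.mul a1))).const_mul k).add
      (V.mul (a0.pow 2)) |>.sub (((a0.pow 2).const_mul k).div_const a)
    refine HasDerivAt.congr_deriv this ?_
    simp
    ring
  · intro x y hm
    have a0 := duy x y hm
    have a1 := duyy x y hm
    have a2 := duxy x y hm
    have i := hasDerivAt_id y
    have V := (i.mul ((hasDerivAt_const y (1:ℝ)).sub i)).neg
    have P := ((i.const_mul 2).const_add (2 * (x / a))).add_const 2
    have := ((((V.mul ((a1.pow 2).sub (a2.pow 2))).add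
      ((a2.mul a1).const_mul (2 * (x * (1 - x / a))))).add (P.mul (a0.mul a1))).const_mul k).add
      (V.mul (a0.pow 2)) |>.sub ((a0.pow 2).const_mul k)
    refine HasDerivAt.congr_deriv this ?_
    simp
    ring
  · intro y hy
    have h0 := hb _ (fr_left ha hy)
    have h1 : y * (1 - y) * uy (0, y) = 0 := by
      rcases eq_or_lt_of_le hy.1 with h | h
      · simp [← h]
      rcases eq_or_lt_of_le hy.2 with h' | h'
      · simp [h']
      rw [t1 y ⟨h, h'⟩, mul_zero]
    simp only [h0]
    linear_combination (-2 * k * ux (0, y)) * h1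
  · intro x hx
    have h0 := hb _ (fr_bot ha hx)
    have h1 : x * (1 - x / a) * ux (x, 0) = 0 := by
      rcases eq_or_lt_of_le hx.1 with h | h
      · simp [← h]
      rcases eq_or_lt_of_le hx.2 with h' | h'
      · simp [h', ha.ne']
      rw [t2 x ⟨h, h'⟩, mul_zero]
    simp only [h0]
    linear_combination (2 * k * uy (x, 0)) * h1
  · intro x hx
    have h0 := hb _ (fr_hyp ha hx)
    simp only [h0]
    rcases eq_or_lt_of_le hx.1 with h | h
    · simp [← h]
    rcases eq_or_lt_of_le hx.2 with h' | h'
    · simp [h', ha.ne']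
    rw [t3 x ⟨h, h'⟩]
    field_simp
    ring

lemma energy_ineq {a k : ℝ} (ha : 0 < a) (hk : 0 ≤ k) {u ux uy : ℝ × ℝ → ℝ}
    (cu : ContinuousOn u (Omg a)) (cux : ContinuousOn ux (Omg a)) (cuy : ContinuousOn uy (Omg a))
    (hid : ∫ p in Omg a, (4 * (k * ux p ^ 2) - (2 + 4 * (p.1 / a)) * u p ^ 2
      + 4 * (p.1 / a + p.2) * (k * uy p ^ 2)) = 0) :
    2 * ∫ p in Omg a, k * ux p ^ 2 ≤ (∫ p in Omg a, u p ^ 2)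
      + 2 * ∫ p in Omg a, p.1 / a * u p ^ 2 := by
  have hc := Omg_isCompact a ha
  have i1 : IntegrableOn (fun p => k * ux p ^ 2) (Omg a) :=
    ContinuousOn.integrableOn_compact hc (by fun_prop)
  have i2 : IntegrableOn (fun p => u p ^ 2) (Omg a) :=
    ContinuousOn.integrableOn_compact hc (by fun_prop)
  have i3 : IntegrableOn (fun p => p.1 / a * u p ^ 2) (Omg a) :=
    ContinuousOn.integrableOn_compact hc (by fun_prop)
  have i4 : IntegrableOn (fun p => 4 * (p.1 / a + p.2) * (k * uy p ^ 2)) (Omg a) :=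
    ContinuousOn.integrableOn_compact hc (by fun_prop)
  have e : ∀ p : ℝ × ℝ, 4 * (k * ux p ^ 2) - (2 + 4 * (p.1 / a)) * u p ^ 2
      + 4 * (p.1 / a + p.2) * (k * uy p ^ 2)
      = (4 * (k * ux p ^ 2) - (2 * u p ^ 2 + 4 * (p.1 / a * u p ^ 2)))
      + 4 * (p.1 / a + p.2) * (k * uy p ^ 2) := fun p => by ring
  simp only [e] at hid
  have j1 : IntegrableOn (fun p => 2 * u p ^ 2 + 4 * (p.1 / a * u p ^ 2)) (Omg a) :=
    (i2.const_mul 2).add (i3.const_mul 4)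
  have j2 : IntegrableOn (fun p => 4 * (k * ux p ^ 2)
      - (2 * u p ^ 2 + 4 * (p.1 / a * u p ^ 2))) (Omg a) :=
    (i1.const_mul 4).sub j1
  rw [integral_add j2 i4, integral_sub (i1.const_mul 4) j1,
    integral_add (i2.const_mul 2) (i3.const_mul 4)] at hid
  simp only [integral_const_mul (4:ℝ) (fun p : ℝ × ℝ => k * ux p ^ 2),
    integral_const_mul (4:ℝ) (fun p : ℝ × ℝ => p.1 / a * u p ^ 2),
    integral_const_mul (2:ℝ) (fun p : ℝ × ℝ => u p ^ 2)] at hid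
  have hn : 0 ≤ ∫ p in Omg a, 4 * (p.1 / a + p.2) * (k * uy p ^ 2) := by
    apply setIntegral_nonneg (Omg_isClosed a).measurableSet
    rintro p ⟨h1, -, h3, -⟩
    positivity
  linarith

lemma step_bound {X : ℝ} (_h0 : 0 ≤ X) (h1 : X ≤ 1) :
    X ≤ (1 / 13) * ∑ n ∈ Finset.range 13, (if (n : ℝ) / 13 < X then (1:ℝ) else 0) := by
  have h2 : ∀ m : ℕ, ∑ n ∈ Finset.range m, (if (n : ℝ) / 13 < X then (1:ℝ) else 0)
      ≥ min (13 * X) m := by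
    intro m
    induction m with
    | zero => simp
    | succ m ih =>
      rw [Finset.sum_range_succ]
      split_ifs with hm
      · push_cast
        have : min (13 * X) (m + 1 : ℝ) ≤ min (13 * X) m + 1 := by
          rw [← min_add_add_right]
          exact min_le_min (by linarith) le_rfl
        linarith
      · have : 13 * X ≤ m := by
          rw [not_lt, le_div_iff₀ (by norm_num)] at hm; linarith
        rw [min_eq_left this] at ih
        have := min_le_left (13 * X) ((m + 1 : ℕ) : ℝ)
        linarith
  have := h2 13
  rw [min_eq_left (by norm_num; linarith)] at this
  linarith

lemma xmass_bound {a : ℝ} (ha : 0 < a) {u : ℝ × ℝ → ℝ} (cu : ContinuousOn u (Omg a)) :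
    ∫ p in Omg a, p.1 / a * u p ^ 2 ≤ (1 / 13) * ∑ n ∈ Finset.range 13,
      ∫ p in Omg a ∩ (Set.Ioo (a * ((n : ℝ) / 13)) (2 * a) ×ˢ Set.Ioo (-1:ℝ) 2), u p ^ 2 := by
  have hc := Omg_isCompact a ha
  have i2 : IntegrableOn (fun p => u p ^ 2) (Omg a) :=
    ContinuousOn.integrableOn_compact hc (by fun_prop)
  have i3 : IntegrableOn (fun p => p.1 / a * u p ^ 2) (Omg a) :=
    ContinuousOn.integrableOn_compact hc (by fun_prop)
  have hSm : ∀ n : ℕ, MeasurableSet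
      (Set.Ioo (a * ((n : ℝ) / 13)) (2 * a) ×ˢ Set.Ioo (-1:ℝ) 2) :=
    fun n => measurableSet_Ioo.prod measurableSet_Ioo
  simp_rw [← setIntegral_indicator (hSm _)]
  rw [← integral_finsetSum _ (fun n _ => i2.indicator (hSm n)), ← integral_const_mul]
  apply setIntegral_mono_on i3 _ (Omg_isClosed a).measurableSet
  · rintro ⟨x, y⟩ ⟨h1, h2, h3, h4⟩
    simp only at h1 h2 h3 h4
    have hX0 := div_nonneg h1 ha.le
    have hX1 := (div_le_one ha).2 h2
    have e : ∀ n : ℕ, (Set.Ioo (a * ((n : ℝ) / 13)) (2 * a) ×ˢ Set.Ioo (-1:ℝ) 2).indicator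
        (fun p => u p ^ 2) (x, y) = (if (n : ℝ) / 13 < x / a then (1:ℝ) else 0) * u (x, y) ^ 2 := by
      intro n
      have : (n : ℝ) / 13 < x / a ↔ a * ((n : ℝ) / 13) < x := by
        rw [lt_div_iff₀ ha, mul_comm]
      by_cases hn : a * ((n : ℝ) / 13) < x
      · rw [Set.indicator_of_mem, if_pos (this.2 hn), one_mul]
        exact ⟨⟨hn, by simp only; linarith⟩, by simp only; linarith, by simp only; linarith⟩
      · rw [Set.indicator_of_notMem, if_neg (fun h => hn (this.1 h)), zero_mul]
        exact fun h => hn h.1.1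
    simp only [e]
    rw [← Finset.sum_mul, ← mul_assoc]
    exact mul_le_mul_of_nonneg_right (step_bound hX0 hX1) (sq_nonneg _)
  · exact (integrable_finsetSum _ (fun n _ => i2.indicator (hSm n))).const_mul _

lemma single_bound {a k : ℝ} (ha : 0 < a) (hk : 0 ≤ k) {u : ℝ × ℝ → ℝ} {U : Set (ℝ × ℝ)}
    (hU : IsOpen U) (hsub : Omg a ⊆ U) (hu : ContDiffOn ℝ 2 u U)
    (heig : ∀ p ∈ Omg a,
      -k * (fderiv ℝ (fun q => fderiv ℝ u q (1, 0)) p (1, 0)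
          + fderiv ℝ (fun q => fderiv ℝ u q (0, 1)) p (0, 1)) = u p)
    (hb : ∀ p ∈ frontier (Omg a), u p = 0) :
    2 * ∫ p in Omg a, k * (fderiv ℝ u p (1, 0)) ^ 2 ≤ (∫ p in Omg a, u p ^ 2)
      + 2 * ∫ p in Omg a, p.1 / a * u p ^ 2 := by
  have hf : ContDiffOn ℝ 1 (fderiv ℝ u) U := hu.fderiv_of_isOpen hU (by norm_num)
  have hg : ∀ v : ℝ × ℝ, ContDiffOn ℝ 1 (fun q => fderiv ℝ u q v) U :=
    fun v => hf.clm_apply contDiffOn_const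
  have hg2 : ∀ v w : ℝ × ℝ, ContinuousOn (fun p => fderiv ℝ (fun q => fderiv ℝ u q v) p w) U :=
    fun v w => ((hg v).continuousOn_fderiv_of_isOpen hU (by norm_num)).clm_apply
      continuousOn_const
  have dl : ∀ {f : ℝ × ℝ → ℝ}, ContDiffOn ℝ 1 f U → ∀ {p v : ℝ × ℝ} {γ : ℝ → ℝ × ℝ} {t : ℝ},
      p ∈ Omg a → HasDerivAt γ v t → γ t = p →
      HasDerivAt (fun s => f (γ s)) (fderiv ℝ f p v) t := by
    intro f hf p v γ t hp hγ hpt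
    subst hpt
    have : DifferentiableAt ℝ f (γ t) :=
      (hf.differentiableOn (by norm_num)).differentiableAt (hU.mem_nhds (hsub hp))
    exact this.hasFDerivAt.comp_hasDerivAt t hγ
  have lx : ∀ x y : ℝ, HasDerivAt (fun s : ℝ => (s, y)) (1, 0) x :=
    fun x y => (hasDerivAt_id x).prodMk (hasDerivAt_const x y)
  have ly : ∀ x y : ℝ, HasDerivAt (fun s : ℝ => (x, s)) (0, 1) y :=
    fun x y => (hasDerivAt_const y x).prodMk (hasDerivAt_id y)
  have hu1 : ContDiffOn ℝ 1 u U := hu.of_le (by norm_num)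
  have symm : ∀ p ∈ Omg a, fderiv ℝ (fun q => fderiv ℝ u q (0, 1)) p (1, 0)
      = fderiv ℝ (fun q => fderiv ℝ u q (1, 0)) p (0, 1) := by
    intro p hp
    have hat : ContDiffAt ℝ 2 u p := hu.contDiffAt (hU.mem_nhds (hsub hp))
    have hs : IsSymmSndFDerivAt ℝ u p := hat.isSymmSndFDerivAt (by simp)
    have hd : DifferentiableAt ℝ (fderiv ℝ u) p :=
      (hf.differentiableOn (by norm_num)).differentiableAt (hU.mem_nhds (hsub hp))
    have e : ∀ v w : ℝ × ℝ, fderiv ℝ (fun q => fderiv ℝ u q v) p w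
        = fderiv ℝ (fderiv ℝ u) p w v := by
      intro v w
      rw [fderiv_clm_apply hd (differentiableAt_const v)]
      simp
    rw [e, e]
    exact hs _ _
  have zero_der : ∀ {γ : ℝ → ℝ × ℝ} {v : ℝ × ℝ} {t α β : ℝ}, t ∈ Set.Ioo α β →
      (∀ s ∈ Set.Icc α β, γ s ∈ frontier (Omg a)) → HasDerivAt γ v t →
      fderiv ℝ u (γ t) v = 0 := by
    intro γ v t α β ht hγ hd
    have hm : γ t ∈ Omg a :=
      (Omg_isClosed a).frontier_subset (hγ t ⟨ht.1.le, ht.2.le⟩)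
    have h1 := dl hu1 hm hd rfl
    have h2 : (fun s => u (γ s)) =ᶠ[nhds t] fun _ => (0:ℝ) := by
      filter_upwards [Icc_mem_nhds ht.1 ht.2] with s hs
      exact hb _ (hγ s hs)
    exact h1.unique ((hasDerivAt_const t (0:ℝ)).congr_of_eventuallyEq h2)
  refine energy_ineq ha hk (hu.continuousOn.mono hsub) ((hg _).continuousOn.mono hsub)
    (uy := fun p => fderiv ℝ u p (0, 1)) ((hg _).continuousOn.mono hsub) ?_
  refine energy_id ha (hu.continuousOn.mono hsub) ((hg _).continuousOn.mono hsub)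
    ((hg _).continuousOn.mono hsub) ((hg2 (1, 0) (1, 0)).mono hsub)
    ((hg2 (1, 0) (0, 1)).mono hsub) ((hg2 (0, 1) (0, 1)).mono hsub)
    (fun x y hm => dl hu1 hm (lx x y) rfl) (fun x y hm => dl hu1 hm (ly x y) rfl)
    (fun x y hm => dl (hg _) hm (lx x y) rfl) (fun x y hm => dl (hg _) hm (ly x y) rfl)
    (fun x y hm => ?_) (fun x y hm => dl (hg _) hm (ly x y) rfl)
    heig hb ?_ ?_ ?_
  · have := dl (hg (0, 1)) hm (lx x y) rfl
    rw [symm _ hm] at this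
    exact this
  · intro y hy
    exact zero_der hy (fun s hs => fr_left ha hs) (ly 0 y)
  · intro x hx
    exact zero_der (γ := fun s : ℝ => (s, 0)) hx (fun s hs => fr_bot ha hs) (lx x 0)
  · intro x hx
    have hd : HasDerivAt (fun s : ℝ => (s, 1 - s / a)) (1, -(1 / a)) x :=
      (hasDerivAt_id x).prodMk (((hasDerivAt_id x).div_const a).const_sub 1)
    have := zero_der hx (fun s hs => fr_hyp ha hs) hd
    have e : ((1:ℝ), -(1 / a)) = (1, 0) - (1 / a) • ((0:ℝ), (1:ℝ)) := by simp
    rw [e, map_sub, map_smul, smul_eq_mul] at this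
    linear_combination this

/-- Let `(u_j)` be a sequence of `L²`-normalized Dirichlet eigenfunctions on the right
triangle `Ω` with semiclassical parameters `h_j → 0`, satisfying the Marklof–Rudnick
spatial equidistribution property: for every open axis-aligned rectangle `R`,
`∫_{Ω∩R} u_j² dV → Area(Ω∩R)/Area(Ω)`.  Then
`limsup_{j→∞} ∫_Ω |h_j ∂_x u_j|² dV ≤ 7/8`. -/
theorem x_energy_upper_bound (a : ℝ) (ha : 0 < a)
    (u : ℕ → ℝ × ℝ → ℝ) (h : ℕ → ℝ)
    (hpos : ∀ j, 0 < h j) (hto : Tendsto h atTop (nhds 0))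
    (hreg : ∀ j, ∃ U : Set (ℝ × ℝ), IsOpen U ∧ Omg a ⊆ U ∧ ContDiffOn ℝ 2 (u j) U)
    (heig : ∀ j, ∀ p ∈ Omg a,
      -(h j) ^ 2 *
        (fderiv ℝ (fun q => fderiv ℝ (u j) q (1, 0)) p (1, 0)
          + fderiv ℝ (fun q => fderiv ℝ (u j) q (0, 1)) p (0, 1))
      = u j p)
    (hbdry : ∀ j, ∀ p ∈ frontier (Omg a), u j p = 0)
    (hnorm : ∀ j, ∫ p in Omg a, (u j p) ^ 2 = 1)
    (hequi : ∀ α β γ δ : ℝ,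
      Tendsto (fun j => ∫ p in Omg a ∩ (Set.Ioo α β ×ˢ Set.Ioo γ δ), (u j p) ^ 2)
        atTop
        (nhds ((volume (Omg a ∩ (Set.Ioo α β ×ˢ Set.Ioo γ δ))).toReal
          / (volume (Omg a)).toReal))) :
    limsup (fun j => ∫ p in Omg a, ((h j) * fderiv ℝ (u j) p (1, 0)) ^ 2) atTop
      ≤ 7 / 8 := by
  have key : ∀ j, 2 * ∫ p in Omg a, ((h j) * fderiv ℝ (u j) p (1, 0)) ^ 2 ≤
      1 + 2 * ((1 / 13) * ∑ n ∈ Finset.range 13,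
      ∫ p in Omg a ∩ (Set.Ioo (a * ((n : ℝ) / 13)) (2 * a) ×ˢ Set.Ioo (-1:ℝ) 2), u j p ^ 2) := by
    intro j
    obtain ⟨U, hU, hsub, hu⟩ := hreg j
    have h1 := single_bound ha (sq_nonneg (h j)) hU hsub hu (heig j) (hbdry j)
    have h2 := xmass_bound ha (hu.continuousOn.mono hsub)
    rw [hnorm j] at h1
    simp only [mul_pow]
    linarith
  have hlim : Tendsto (fun j => 1 + 2 * ((1 / 13) * ∑ n ∈ Finset.range 13,
      ∫ p in Omg a ∩ (Set.Ioo (a * ((n : ℝ) / 13)) (2 * a) ×ˢ Set.Ioo (-1:ℝ) 2), u j p ^ 2))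
      atTop (nhds (1 + 2 * ((1 / 13) * ∑ n ∈ Finset.range 13, (1 - (n : ℝ) / 13) ^ 2))) := by
    refine Tendsto.const_add _ (Tendsto.const_mul _ (Tendsto.const_mul _
      (tendsto_finsetSum _ fun n hn => ?_)))
    have h1 := hequi (a * ((n : ℝ) / 13)) (2 * a) (-1) 2
    have hn' : (n : ℝ) ≤ 13 := by exact_mod_cast (Finset.mem_range.1 hn).le
    rw [area_part ha (by positivity) (by linarith), area_Omg ha] at h1
    convert h1 using 2
    field_simp
  have hlt : 1 + 2 * ((1 / 13) * ∑ n ∈ Finset.range 13, (1 - (n : ℝ) / 13) ^ 2) < 7 / 4 := by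
    simp only [Finset.sum_range_succ, Finset.sum_range_zero]
    norm_num
  apply limsup_le_of_le
  · refine IsCoboundedUnder.of_frequently_ge (a := 0) (Frequently.of_forall fun j => ?_)
    exact integral_nonneg fun p => sq_nonneg _
  · filter_upwards [hlim.eventually_lt_const hlt] with j hj
    linarith [key j]
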